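/- Let u₀ satisfy (2.8), for each ε > 0 let u_{0ε} satisfy (3.13) and let u_ε ∈ C^{2,1}(Q) ∩ C(Q̄) be the solution of the regularised problem (3.11). Then the zero set of u_ε concentrates on N as ε → 0: sup { dist((x,t), N) : (x,t) ∈ Q, u_ε(x,t) = 0 } → 0 as ε → 0. -/

import Mathlib

open Set Filter MeasureTheory Topology

/-- Partial derivative in `x` of `u(x,t)`. -/
noncomputable def pdx (u : ℝ → ℝ → ℝ) (x t : ℝ) : ℝ := deriv (fun y => u y t) x

/-- Second partial derivative in `x` of `u(x,t)`. -/
noncomputable def pdxx (u : ℝ → ℝ → ℝ) (x t : ℝ) : ℝ := deriv (fun y => pdx u y t) x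

/-- Partial derivative in `t` of `u(x,t)`, one-sided at `t = T`. -/
noncomputable def pdtW (T : ℝ) (u : ℝ → ℝ → ℝ) (x t : ℝ) : ℝ :=
  derivWithin (fun s => u x s) (Set.Iic T) t

/-- `Q = (a,b) × (0,T]`. -/
def QT (a b T : ℝ) : Set (ℝ × ℝ) := Set.Ioo a b ×ˢ Set.Ioc 0 T

/-- `N = N₀ × [0,T]`. -/
def NSet (N₀ : Set ℝ) (T : ℝ) : Set (ℝ × ℝ) := N₀ ×ˢ Set.Icc 0 T

/-- Condition (2.8): `u₀` is continuous, `u₀(a) = -1`, `u₀(b) = 1`, the zeros of `u₀`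
form the finite set `N₀ ⊆ (a,b)`, and `u₀` changes sign at each of its zeros. -/
structure InitData (a b : ℝ) (N₀ : Set ℝ) (u₀ : ℝ → ℝ) : Prop where
  cont : ContinuousOn u₀ (Set.Icc a b)
  bdry_a : u₀ a = -1
  bdry_b : u₀ b = 1
  fin : N₀.Finite
  sub : N₀ ⊆ Set.Ioo a b
  zeros : ∀ x ∈ Set.Icc a b, (u₀ x = 0 ↔ x ∈ N₀)
  sign_change : ∀ x ∈ N₀, ∀ δ > 0,
    ∃ y ∈ Set.Ioo (x - δ) x, ∃ z ∈ Set.Ioo x (x + δ), u₀ y * u₀ z < 0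

/-- A classical solution of the limit problem (2.7): `u ∈ C(Q̄)` vanishing exactly on `N`,
`C^{2,1}` on `Q ∖ N`, with boundary values `∓1`, initial value `u₀`, satisfying
`u_t = |u| u_xx + u(1-|u|)` on `Q ∖ N`. -/
structure IsClassicalSol (a b T : ℝ) (N₀ : Set ℝ) (u₀ : ℝ → ℝ) (u : ℝ → ℝ → ℝ) : Prop where
  cont : ContinuousOn (fun p : ℝ × ℝ => u p.1 p.2) (Set.Icc a b ×ˢ Set.Icc 0 T)
  zero_iff : ∀ x ∈ Set.Icc a b, ∀ t ∈ Set.Icc 0 T, (u x t = 0 ↔ x ∈ N₀)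
  diff_x : ∀ p ∈ QT a b T \ NSet N₀ T, DifferentiableAt ℝ (fun y => u y p.2) p.1
  diff_xx : ∀ p ∈ QT a b T \ NSet N₀ T, DifferentiableAt ℝ (fun y => pdx u y p.2) p.1
  diff_t : ∀ p ∈ QT a b T \ NSet N₀ T,
    DifferentiableWithinAt ℝ (fun s => u p.1 s) (Set.Iic T) p.2
  cont_x : ContinuousOn (fun p : ℝ × ℝ => pdx u p.1 p.2) (QT a b T \ NSet N₀ T)
  cont_xx : ContinuousOn (fun p : ℝ × ℝ => pdxx u p.1 p.2) (QT a b T \ NSet N₀ T)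
  cont_t : ContinuousOn (fun p : ℝ × ℝ => pdtW T u p.1 p.2) (QT a b T \ NSet N₀ T)
  bdry_a : ∀ t ∈ Set.Ioc 0 T, u a t = -1
  bdry_b : ∀ t ∈ Set.Ioc 0 T, u b t = 1
  init : ∀ x ∈ Set.Ioo a b, u x 0 = u₀ x
  pde : ∀ p ∈ QT a b T \ NSet N₀ T,
    pdtW T u p.1 p.2 = |u p.1 p.2| * pdxx u p.1 p.2 + u p.1 p.2 * (1 - |u p.1 p.2|)

/-- `U_ε(φ) = 2∫₀^φ √(ε + s²) ds` (equation (1.3)); its inverse is `Φ_ε`. -/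
noncomputable def Ureg (ε φ : ℝ) : ℝ := 2 * ∫ s in (0:ℝ)..φ, Real.sqrt (ε + s ^ 2)

/-- A (classical) solution of the regularised problem (3.11):
`u ∈ C(Q̄) ∩ C^{2,1}(Q)` with
`u_t = (ε + Φ_ε²(u)) u_xx + Φ_ε(u)(1 - Φ_ε²(u)) √(ε + Φ_ε²(u))` in `Q`,
boundary values `∓u_{1ε}` and initial value `u_{0ε}`. -/
structure IsRegSol (a b T ε : ℝ) (Φ : ℝ → ℝ) (u1 : ℝ) (u₀ε : ℝ → ℝ)
    (u : ℝ → ℝ → ℝ) : Prop where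
  cont : ContinuousOn (fun p : ℝ × ℝ => u p.1 p.2) (Set.Icc a b ×ˢ Set.Icc 0 T)
  diff_x : ∀ p ∈ QT a b T, DifferentiableAt ℝ (fun y => u y p.2) p.1
  diff_xx : ∀ p ∈ QT a b T, DifferentiableAt ℝ (fun y => pdx u y p.2) p.1
  diff_t : ∀ p ∈ QT a b T, DifferentiableWithinAt ℝ (fun s => u p.1 s) (Set.Iic T) p.2
  cont_x : ContinuousOn (fun p : ℝ × ℝ => pdx u p.1 p.2) (QT a b T)
  cont_xx : ContinuousOn (fun p : ℝ × ℝ => pdxx u p.1 p.2) (QT a b T)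
  cont_t : ContinuousOn (fun p : ℝ × ℝ => pdtW T u p.1 p.2) (QT a b T)
  bdry_a : ∀ t ∈ Set.Ioc 0 T, u a t = -u1
  bdry_b : ∀ t ∈ Set.Ioc 0 T, u b t = u1
  init : ∀ x ∈ Set.Icc a b, u x 0 = u₀ε x
  pde : ∀ p ∈ QT a b T,
    pdtW T u p.1 p.2 = (ε + Φ (u p.1 p.2) ^ 2) * pdxx u p.1 p.2
      + Φ (u p.1 p.2) * (1 - Φ (u p.1 p.2) ^ 2) * Real.sqrt (ε + Φ (u p.1 p.2) ^ 2)

/-- Second derivative test (necessary condition) at a local minimum. -/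
lemma IsLocalMin.deriv_deriv_nonneg {f : ℝ → ℝ} {x : ℝ} (h : IsLocalMin f x)
    (hc : ContinuousAt f x) : 0 ≤ deriv (deriv f) x := by
  by_contra! hneg
  have hmax : IsLocalMax f x := isLocalMax_of_deriv_deriv_neg hneg h.deriv_eq_zero hc
  have heq : f =ᶠ[𝓝 x] fun _ => f x := by
    filter_upwards [h, hmax] with y h1 h2 using le_antisymm h2 h1
  have : deriv (deriv f) x = 0 := by
    rw [heq.deriv.deriv_eq]
    simp
  linarith

/-- A function lying above its endpoint value on the left has nonpositive left derivative there. -/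
lemma HasDerivWithinAt.nonpos_of_forall_ge_left {f : ℝ → ℝ} {f' s₀ t T : ℝ} (hs : s₀ < t)
    (htT : t ≤ T) (hf : HasDerivWithinAt f f' (Iic T) t) (h : ∀ s ∈ Ioo s₀ t, f t ≤ f s) :
    f' ≤ 0 := by
  have h1 : HasDerivWithinAt f f' (Iio t) t := hf.mono fun s hs' => (le_of_lt hs').trans htT
  rw [hasDerivWithinAt_iff_tendsto_slope' (by simp)] at h1
  refine le_of_tendsto h1 ?_
  filter_upwards [Ioo_mem_nhdsLT hs] with s hs'
  rw [slope_def_field]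
  exact div_nonpos_of_nonneg_of_nonpos (by linarith [h s hs']) (by linarith [hs'.2])

/-- Comparison principle by the first touching point: a function `w` that starts strictly below `u`
on the parabolic boundary stays strictly below `u` if the derivative inequalities that hold at a
first touching point are contradictory. -/
lemma lt_of_no_first_touch {a b T : ℝ} {u w wx wxx wt : ℝ → ℝ → ℝ}
    (hu : ContinuousOn (fun p : ℝ × ℝ => u p.1 p.2) (Icc a b ×ˢ Icc 0 T))
    (hw : Continuous (fun p : ℝ × ℝ => w p.1 p.2))
    (hux : ∀ p ∈ QT a b T, DifferentiableAt ℝ (fun y => u y p.2) p.1)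
    (huxx : ∀ p ∈ QT a b T, DifferentiableAt ℝ (fun y => pdx u y p.2) p.1)
    (hut : ∀ p ∈ QT a b T, DifferentiableWithinAt ℝ (fun s => u p.1 s) (Iic T) p.2)
    (hwx : ∀ x t, HasDerivAt (fun y => w y t) (wx x t) x)
    (hwxx : ∀ x t, HasDerivAt (fun y => wx y t) (wxx x t) x)
    (hwt : ∀ x t, HasDerivAt (fun s => w x s) (wt x t) t)
    (ha : ∀ t ∈ Icc 0 T, w a t < u a t) (hb : ∀ t ∈ Icc 0 T, w b t < u b t)
    (h0 : ∀ x ∈ Icc a b, w x 0 < u x 0)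
    (htouch : ∀ x t, (x, t) ∈ QT a b T → u x t = w x t → wxx x t ≤ pdxx u x t →
      pdtW T u x t ≤ wt x t → False) :
    ∀ x ∈ Icc a b, ∀ t ∈ Icc 0 T, w x t < u x t := by
  set K : Set (ℝ × ℝ) := Icc a b ×ˢ Icc 0 T
  have hKc : IsCompact K := isCompact_Icc.prod isCompact_Icc
  have hD : ContinuousOn (fun p : ℝ × ℝ => u p.1 p.2 - w p.1 p.2) K := hu.sub hw.continuousOn
  set Z : Set (ℝ × ℝ) := K ∩ (fun p : ℝ × ℝ => u p.1 p.2 - w p.1 p.2) ⁻¹' Iic 0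
  have hZc : IsCompact Z :=
    hKc.of_isClosed_subset (hD.preimage_isClosed_of_isClosed hKc.isClosed isClosed_Iic)
      inter_subset_left
  intro x hx t ht
  by_contra! hle
  obtain ⟨⟨x₁, t₁⟩, hz, hmin⟩ := hZc.exists_isMinOn ⟨(x, t), ⟨hx, ht⟩, by simpa using hle⟩
    continuous_snd.continuousOn
  obtain ⟨⟨hx₁, ht₁⟩, hz1⟩ := hz
  simp only [mem_preimage, mem_Iic, sub_nonpos] at hz1 hx₁ ht₁
  have hbefore : ∀ y ∈ Icc a b, ∀ s ∈ Icc 0 T, s < t₁ → w y s < u y s := by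
    intro y hy s hs hst
    by_contra! hcon
    have : t₁ ≤ s := hmin (a := (y, s)) ⟨⟨hy, hs⟩, by simpa using hcon⟩
    linarith
  have ht0 : 0 < t₁ := by
    rcases ht₁.1.eq_or_lt with h | h
    · have := h0 x₁ hx₁
      rw [h] at this
      linarith
    · exact h
  have hxa : a < x₁ := by
    rcases hx₁.1.eq_or_lt with h | h
    · have := ha t₁ ht₁
      rw [h] at this
      linarith
    · exact h
  have hxb : x₁ < b := by
    rcases hx₁.2.eq_or_lt with h | h
    · have := hb t₁ ht₁
      rw [← h] at this
      linarith
    · exact h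
  have hge : ∀ y ∈ Icc a b, w y t₁ ≤ u y t₁ := by
    intro y hy
    have hc : ContinuousOn (fun s => u y s - w y s) (Icc 0 T) :=
      hD.comp (f := fun s : ℝ => (y, s)) (by fun_prop) fun s hs => ⟨hy, hs⟩
    have hc' : Tendsto (fun s => u y s - w y s) (𝓝[Ioo 0 t₁] t₁) (𝓝 (u y t₁ - w y t₁)) :=
      (hc t₁ ht₁).mono fun s hs => ⟨hs.1.le, hs.2.le.trans ht₁.2⟩
    have : (𝓝[Ioo 0 t₁] t₁).NeBot := by
      rw [nhdsWithin_Ioo_eq_nhdsLT ht0]; infer_instance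
    have := ge_of_tendsto hc' (b := 0) (by
      filter_upwards [self_mem_nhdsWithin] with s hs
      linarith [hbefore y hy s ⟨hs.1.le, hs.2.le.trans ht₁.2⟩ hs.2])
    linarith
  have heq : u x₁ t₁ = w x₁ t₁ := le_antisymm hz1 (hge x₁ hx₁)
  have hQ : (x₁, t₁) ∈ QT a b T := ⟨⟨hxa, hxb⟩, ht0, ht₁.2⟩
  have hnhds : Ioo a b ∈ 𝓝 x₁ := Ioo_mem_nhds hxa hxb
  refine htouch x₁ t₁ hQ heq ?_ ?_
  · have hlm : IsLocalMin (fun y => u y t₁ - w y t₁) x₁ := by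
      filter_upwards [hnhds] with y hy
      have := hge y ⟨hy.1.le, hy.2.le⟩
      linarith
    have hnn := hlm.deriv_deriv_nonneg ((hux _ hQ).continuousAt.sub (hwx x₁ t₁).continuousAt)
    have hev : deriv (fun y => u y t₁ - w y t₁) =ᶠ[𝓝 x₁] fun y => pdx u y t₁ - wx y t₁ := by
      filter_upwards [hnhds] with y hy
      exact ((hux (y, t₁) ⟨hy, ht0, ht₁.2⟩).hasDerivAt.sub (hwx y t₁)).deriv
    have hdd : deriv (fun y => pdx u y t₁ - wx y t₁) x₁ = pdxx u x₁ t₁ - wxx x₁ t₁ :=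
      ((huxx _ hQ).hasDerivAt.sub (hwxx x₁ t₁)).deriv
    rw [hev.deriv_eq, hdd] at hnn
    linarith
  · have hd : HasDerivWithinAt (fun s => u x₁ s - w x₁ s) (pdtW T u x₁ t₁ - wt x₁ t₁) (Iic T) t₁ :=
      (hut _ hQ).hasDerivWithinAt.sub (hwt x₁ t₁).hasDerivWithinAt
    have := hd.nonpos_of_forall_ge_left ht0 ht₁.2 fun s hs => by
      linarith [hbefore x₁ hx₁ s ⟨hs.1.le, hs.2.le.trans ht₁.2⟩ hs.2]
    linarith

lemma Ureg_neg (ε φ : ℝ) : Ureg ε (-φ) = -Ureg ε φ := by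
  unfold Ureg
  have h := intervalIntegral.integral_comp_neg (a := 0) (b := φ) fun s => √(ε + s ^ 2)
  simp only [neg_sq, neg_zero] at h
  rw [intervalIntegral.integral_symm, ← h]
  ring

lemma sq_le_Ureg {ε φ : ℝ} (hε : 0 ≤ ε) (hφ : 0 ≤ φ) : φ ^ 2 ≤ Ureg ε φ := by
  have h : ∫ s in (0 : ℝ)..φ, s ≤ ∫ s in (0 : ℝ)..φ, √(ε + s ^ 2) := by
    refine intervalIntegral.integral_mono_on hφ (by simp)
      (Continuous.intervalIntegrable (by fun_prop) _ _) fun s hs => Real.le_sqrt_of_sq_le ?_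
    linarith
  rw [integral_id] at h
  unfold Ureg
  linarith

section InverseOfUreg

variable {ε : ℝ} {Φ : ℝ → ℝ}

lemma neg_of_leftInverse_rightInverse_Ureg (h₁ : Function.LeftInverse Φ (Ureg ε))
    (h₂ : Function.RightInverse Φ (Ureg ε)) (v : ℝ) : Φ (-v) = -Φ v := by
  conv_lhs => rw [← h₂ v, ← Ureg_neg, h₁]

lemma nonneg_of_rightInverse_Ureg (hε : 0 ≤ ε) (h : Function.RightInverse Φ (Ureg ε)) {v : ℝ}
    (hv : 0 ≤ v) : 0 ≤ Φ v := by
  by_contra! hneg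
  have h1 := sq_le_Ureg hε (φ := -Φ v) (by linarith)
  rw [Ureg_neg, h v] at h1
  nlinarith

lemma nonpos_of_rightInverse_Ureg (hε : 0 ≤ ε) (h : Function.RightInverse Φ (Ureg ε)) {v : ℝ}
    (hv : v ≤ 0) : Φ v ≤ 0 := by
  by_contra! hpos
  have h1 := sq_le_Ureg hε hpos.le
  rw [h v] at h1
  nlinarith

lemma sq_le_abs_of_rightInverse_Ureg (hε : 0 ≤ ε) (h : Function.RightInverse Φ (Ureg ε)) (v : ℝ) :
    Φ v ^ 2 ≤ |v| := by
  rcases le_total 0 (Φ v) with hv | hv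
  · have h1 := sq_le_Ureg hε hv
    rw [h v] at h1
    exact h1.trans (le_abs_self v)
  · have h1 := sq_le_Ureg hε (φ := -Φ v) (by linarith)
    rw [Ureg_neg, h v, neg_sq] at h1
    exact h1.trans (neg_le_abs v)

end InverseOfUreg

/-- The logarithmic profile with slope `c - arsinh (ξ / ε)` vanishing at `0`. -/
noncomputable def logProfile (ε c ξ : ℝ) : ℝ :=
  ξ * (c - Real.arsinh (ξ / ε)) + √(ε ^ 2 + ξ ^ 2) - ε

section LogProfile

variable {ε : ℝ}

lemma hasDerivAt_arsinh_div (hε : 0 < ε) (ξ : ℝ) :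
    HasDerivAt (fun z => Real.arsinh (z / ε)) (1 / √(ε ^ 2 + ξ ^ 2)) ξ := by
  refine HasDerivAt.congr_deriv ((hasDerivAt_id ξ).div_const ε).arsinh ?_
  have h : √(ε ^ 2 + ξ ^ 2) = ε * √(1 + (ξ / ε) ^ 2) := by
    rw [← Real.sqrt_sq hε.le, ← Real.sqrt_mul (sq_nonneg _), Real.sqrt_sq hε.le]
    congr 1
    field_simp
  rw [h]
  have h2 : 0 < √(1 + (ξ / ε) ^ 2) := Real.sqrt_pos.2 (by positivity)
  simp only [id, smul_eq_mul]
  field_simp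

lemma hasDerivAt_logProfile (hε : 0 < ε) (c ξ : ℝ) :
    HasDerivAt (logProfile ε c) (c - Real.arsinh (ξ / ε)) ξ := by
  have hpos : 0 < ε ^ 2 + ξ ^ 2 := by positivity
  have h1 := (hasDerivAt_id ξ).mul ((hasDerivAt_arsinh_div hε ξ).const_sub c)
  have h2 := (((hasDerivAt_id ξ).pow 2).const_add (ε ^ 2)).sqrt hpos.ne'
  refine HasDerivAt.congr_deriv ((h1.add h2).sub_const ε) ?_
  have h3 : 0 < √(ε ^ 2 + ξ ^ 2) := Real.sqrt_pos.2 hpos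
  simp
  field_simp
  ring

lemma differentiable_logProfile (hε : 0 < ε) (c : ℝ) : Differentiable ℝ (logProfile ε c) :=
  fun ξ => (hasDerivAt_logProfile hε c ξ).differentiableAt

lemma logProfile_zero (hε : 0 < ε) (c : ℝ) : logProfile ε c 0 = 0 := by
  simp [logProfile, Real.sqrt_sq hε.le]

lemma mul_sub_le_logProfile_sub (hε : 0 < ε) (c : ℝ) {x y : ℝ} (h : x ≤ y) :
    (c - Real.arsinh (y / ε)) * (y - x) ≤ logProfile ε c y - logProfile ε c x := by
  refine (convex_Iic y).mul_sub_le_image_sub_of_le_deriv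
    (differentiable_logProfile hε c).continuous.continuousOn
    (differentiable_logProfile hε c).differentiableOn (fun z hz => ?_) x h y self_mem_Iic h
  rw [(hasDerivAt_logProfile hε c z).deriv]
  have hz' : z ∈ Iic y := interior_subset hz
  have : Real.arsinh (z / ε) ≤ Real.arsinh (y / ε) :=
    Real.arsinh_le_arsinh.2 (div_le_div_of_nonneg_right hz' hε.le)
  linarith

lemma abs_logProfile_le (hε : 0 < ε) {c ξ : ℝ} (h : 1 ≤ c - Real.arsinh (ξ / ε)) :
    |logProfile ε c ξ| ≤ 2 * |ξ| * (c - Real.arsinh (ξ / ε)) := by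
  set S := c - Real.arsinh (ξ / ε) with hS
  have h1 : ε ≤ √(ε ^ 2 + ξ ^ 2) := Real.le_sqrt_of_sq_le (by nlinarith [sq_nonneg ξ])
  have h2 : √(ε ^ 2 + ξ ^ 2) ≤ ε + |ξ| := by
    rw [Real.sqrt_le_left (by positivity)]
    nlinarith [sq_abs ξ, abs_nonneg ξ]
  calc |logProfile ε c ξ| = |ξ * S + (√(ε ^ 2 + ξ ^ 2) - ε)| := by
        rw [logProfile, ← hS]; congr 1; ring
    _ ≤ |ξ * S| + |√(ε ^ 2 + ξ ^ 2) - ε| := abs_add_le _ _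
    _ = |ξ| * S + (√(ε ^ 2 + ξ ^ 2) - ε) := by
        rw [abs_mul, abs_of_nonneg (zero_le_one.trans h), abs_of_nonneg (sub_nonneg.2 h1)]
    _ ≤ 2 * |ξ| * S := by nlinarith [abs_nonneg ξ]

end LogProfile

section RationalBump

variable {r : ℝ}

lemma hasDerivAt_rationalBump (hr : 0 < r) (y : ℝ) :
    HasDerivAt (fun z => r ^ 2 / (r ^ 2 + z ^ 2)) (-(2 * r ^ 2 * y) / (r ^ 2 + y ^ 2) ^ 2) y := by
  have hpos : 0 < r ^ 2 + y ^ 2 := by positivity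
  refine HasDerivAt.congr_deriv ((hasDerivAt_const y (r ^ 2)).div
    (((hasDerivAt_id y).pow 2).const_add (r ^ 2)) hpos.ne') ?_
  simp
  ring

lemma hasDerivAt_deriv_rationalBump (hr : 0 < r) (y : ℝ) :
    HasDerivAt (fun z => -(2 * r ^ 2 * z) / (r ^ 2 + z ^ 2) ^ 2)
      (r ^ 2 * (6 * y ^ 2 - 2 * r ^ 2) / (r ^ 2 + y ^ 2) ^ 3) y := by
  have hpos : 0 < r ^ 2 + y ^ 2 := by positivity
  refine HasDerivAt.congr_deriv ((((hasDerivAt_id y).const_mul (2 * r ^ 2)).neg).div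
    ((((hasDerivAt_id y).pow 2).const_add (r ^ 2)).pow 2) (pow_pos hpos 2).ne') ?_
  simp
  field_simp
  ring

lemma sq_deriv_rationalBump_le (hr : 0 < r) (y : ℝ) :
    (-(2 * r ^ 2 * y) / (r ^ 2 + y ^ 2) ^ 2) ^ 2 ≤ 1 / r ^ 2 := by
  have hpos : 0 < r ^ 2 + y ^ 2 := by positivity
  have h1 : |2 * r * y| ≤ r ^ 2 + y ^ 2 := by
    rw [abs_le]; constructor <;> nlinarith [sq_nonneg (r - y), sq_nonneg (r + y)]
  have h2 : (2 * r * y) ^ 2 ≤ (r ^ 2 + y ^ 2) ^ 2 := sq_le_sq' (abs_le.1 h1).1 (abs_le.1 h1).2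
  have h3 : (r ^ 2) ^ 2 ≤ (r ^ 2 + y ^ 2) ^ 2 := by gcongr; nlinarith [sq_nonneg y]
  rw [div_pow, div_le_div_iff₀ (by positivity) (by positivity)]
  calc (-(2 * r ^ 2 * y)) ^ 2 * r ^ 2 = (2 * r * y) ^ 2 * (r ^ 2) ^ 2 := by ring
    _ ≤ (r ^ 2 + y ^ 2) ^ 2 * (r ^ 2 + y ^ 2) ^ 2 := by gcongr
    _ = 1 * ((r ^ 2 + y ^ 2) ^ 2) ^ 2 := by ring

lemma neg_le_deriv_deriv_rationalBump (hr : 0 < r) (y : ℝ) :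
    -(2 / r ^ 2) ≤ r ^ 2 * (6 * y ^ 2 - 2 * r ^ 2) / (r ^ 2 + y ^ 2) ^ 3 := by
  have hpos : 0 < r ^ 2 + y ^ 2 := by positivity
  rw [← neg_div, div_le_div_iff₀ (by positivity) (by positivity), ← sub_nonneg]
  have : r ^ 2 * (6 * y ^ 2 - 2 * r ^ 2) * r ^ 2 - -2 * (r ^ 2 + y ^ 2) ^ 3
      = 12 * r ^ 4 * y ^ 2 + 6 * r ^ 2 * y ^ 4 + 2 * y ^ 6 := by ring
  rw [this]
  positivity

lemma deriv_deriv_rationalBump_nonneg (hr : 0 < r) {y : ℝ}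
    (h : r ^ 2 / (r ^ 2 + y ^ 2) ≤ 3 / 4) :
    0 ≤ r ^ 2 * (6 * y ^ 2 - 2 * r ^ 2) / (r ^ 2 + y ^ 2) ^ 3 := by
  rw [div_le_div_iff₀ (by positivity) (by positivity)] at h
  have : 0 ≤ 6 * y ^ 2 - 2 * r ^ 2 := by linarith
  positivity

end RationalBump

/-- The reaction term is bounded below by `-2` for nonpositive values. -/
lemma neg_two_le_reaction {ε φ : ℝ} (hε1 : ε ≤ 1) (hφ : φ ≤ 0) :
    -2 ≤ φ * (1 - φ ^ 2) * √(ε + φ ^ 2) := by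
  have hs := Real.sqrt_nonneg (ε + φ ^ 2)
  rcases le_total φ (-1) with h | h
  · have h1 : 0 ≤ φ * (1 - φ ^ 2) := by nlinarith
    nlinarith [mul_nonneg h1 hs]
  · have hs2 : √(ε + φ ^ 2) ≤ 2 := by
      rw [Real.sqrt_le_left (by norm_num)]
      nlinarith
    have h1 : -1 ≤ φ * (1 - φ ^ 2) := by nlinarith [mul_nonneg (sq_nonneg φ) (neg_nonneg.2 hφ)]
    nlinarith

/-- The strict subsolution inequality for the barrier `logProfile ε c ξ`, in terms of the values
`ξ`, `g₁`, `g₂` of the moving coordinate and the first two derivatives of the bump. -/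
lemma barrier_subsolution {ε c ξ R r T g₁ g₂ φ : ℝ} (hε : 0 < ε) (hR : 0 < R) (hr : 0 < r)
    (hT : 0 < T) (hεR : ε ≤ R) (hR1 : 4 * R ≤ 1) (hRr : 768 * T * R ≤ r ^ 2)
    (hS : 1 ≤ c - Real.arsinh (ξ / ε)) (hg₁ : g₁ ^ 2 ≤ 1 / r ^ 2) (hg₂ : -(2 / r ^ 2) ≤ g₂)
    (hneg : ξ < 0 → 0 ≤ g₂) (hc : 2 < 3 / 4 * (R / (4 * T)) * c)
    (hle : logProfile ε c ξ ≤ 4 * R) (hφ : φ ^ 2 ≤ |logProfile ε c ξ|)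
    (hφ0 : 0 ≤ logProfile ε c ξ → 0 ≤ φ) (hφ1 : logProfile ε c ξ ≤ 0 → φ ≤ 0) :
    -(R / (4 * T)) * (c - Real.arsinh (ξ / ε)) <
      (ε + φ ^ 2) * (-(1 / √(ε ^ 2 + ξ ^ 2)) * (4 * R * g₁) ^ 2
        + (c - Real.arsinh (ξ / ε)) * (4 * R * g₂)) + φ * (1 - φ ^ 2) * √(ε + φ ^ 2) := by
  have hW := abs_logProfile_le hε hS
  have hlow := mul_sub_le_logProfile_sub hε c (x := ξ) (y := 0)
  have hhigh := mul_sub_le_logProfile_sub hε c (x := 0) (y := ξ)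
  rw [logProfile_zero hε] at hlow hhigh
  have hSc : ξ ≤ 0 → c ≤ c - Real.arsinh (ξ / ε) := fun h => by
    have := Real.arsinh_nonpos_iff.2 (div_nonpos_of_nonpos_of_nonneg h hε.le)
    linarith
  set S := c - Real.arsinh (ξ / ε)
  set W := logProfile ε c ξ
  set q := √(ε ^ 2 + ξ ^ 2)
  set V := R / (4 * T) with hV
  have hVpos : 0 < V := by positivity
  have hqε : ε ≤ q := Real.le_sqrt_of_sq_le (by nlinarith [sq_nonneg ξ])
  have hqξ : |ξ| ≤ q := Real.le_sqrt_of_sq_le (by nlinarith [sq_nonneg ε, sq_abs ξ])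
  have hqpos : 0 < q := hε.trans_le hqε
  have hEq : (ε + φ ^ 2) / q ≤ 3 * S := by
    have h1 : |ξ| * S ≤ q * S := mul_le_mul_of_nonneg_right hqξ (zero_le_one.trans hS)
    have h2 : q ≤ q * S := le_mul_of_one_le_right hqpos.le hS
    rw [div_le_iff₀ hqpos]
    linarith
  have hRV : R ^ 2 / r ^ 2 ≤ V / 192 := by
    rw [hV, div_div, div_le_div_iff₀ (by positivity) (by positivity)]
    nlinarith
  have hgrad : (4 * R * g₁) ^ 2 ≤ 16 * (R ^ 2 / r ^ 2) := by
    calc (4 * R * g₁) ^ 2 = 16 * R ^ 2 * g₁ ^ 2 := by ring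
      _ ≤ 16 * R ^ 2 * (1 / r ^ 2) := by gcongr
      _ = _ := by ring
  have hconv : (ε + φ ^ 2) / q * (4 * R * g₁) ^ 2 ≤ V / 4 * S := by
    calc (ε + φ ^ 2) / q * (4 * R * g₁) ^ 2 ≤ 3 * S * (16 * (V / 192)) := by
          gcongr
          linarith
      _ = V / 4 * S := by ring
  have hsplit : (ε + φ ^ 2) * (-(1 / q) * (4 * R * g₁) ^ 2 + S * (4 * R * g₂))
      = -((ε + φ ^ 2) / q * (4 * R * g₁) ^ 2) + (ε + φ ^ 2) * S * (4 * R * g₂) := by ring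
  rw [hsplit]
  rcases lt_or_ge ξ 0 with hξ | hξ
  · have hS' := hSc hξ.le
    simp only [zero_div, Real.arsinh_zero, sub_zero, zero_sub] at hlow
    have hcpos : 0 < c := by
      by_contra! h
      have := mul_nonneg hVpos.le (neg_nonneg.2 h)
      linarith
    have hWneg : W ≤ 0 := by nlinarith [hlow hξ.le]
    have hF := neg_two_le_reaction (ε := ε) (by linarith) (hφ1 hWneg)
    have hg := hneg hξ
    have hpos : 0 ≤ (ε + φ ^ 2) * S * (4 * R * g₂) := by positivity
    have : 3 / 4 * V * c ≤ 3 / 4 * V * S := by gcongr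
    linarith
  · have hWnn : 0 ≤ W := by nlinarith [hhigh hξ]
    have hφnn := hφ0 hWnn
    rw [abs_of_nonneg hWnn] at hφ
    have hF : 0 ≤ φ * (1 - φ ^ 2) * √(ε + φ ^ 2) :=
      mul_nonneg (mul_nonneg hφnn (by linarith)) (Real.sqrt_nonneg _)
    have hE : ε + φ ^ 2 ≤ 5 * R := by linarith
    have hdiff : -(V / 4 * S) ≤ (ε + φ ^ 2) * S * (4 * R * g₂) := by
      have h1 : (ε + φ ^ 2) * S * (4 * R * -g₂) ≤ 5 * R * S * (4 * R * (2 / r ^ 2)) := by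
        have : -g₂ ≤ 2 / r ^ 2 := by linarith
        calc (ε + φ ^ 2) * S * (4 * R * -g₂) ≤ (ε + φ ^ 2) * S * (4 * R * (2 / r ^ 2)) := by gcongr
          _ ≤ _ := by gcongr
      have h2 : 5 * R * S * (4 * R * (2 / r ^ 2)) = 40 * S * (R ^ 2 / r ^ 2) := by ring
      have h3 : 40 * S * (R ^ 2 / r ^ 2) ≤ 40 * S * (V / 192) := by gcongr
      have h4 : 0 ≤ V * S := by positivity
      linarith
    linarith [mul_pos hVpos (zero_lt_one.trans_le hS)]

/-- If the initial datum exceeds `4 * R` on the `r`-neighbourhood of `x₀`, then for small `ε` the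
regularised solution stays positive at `x₀` up to time `T`. -/
lemma IsRegSol.pos_of_initial_bump {a b T ε R r K x₀ u1 : ℝ} {Φ u₀ : ℝ → ℝ} {u : ℝ → ℝ → ℝ}
    (hsol : IsRegSol a b T ε Φ u1 u₀ u) (h₂ : Function.RightInverse Φ (Ureg ε))
    (hab : a < b) (hT : 0 < T) (hε : 0 < ε) (hR : 0 < R) (hr : 0 < r) (hεR : ε ≤ R)
    (hR1 : 4 * R ≤ 1) (hRr : 768 * T * R ≤ r ^ 2)
    (hK : K < R / 2 * Real.arsinh (2 * R / ε))
    (hc : 2 < 3 / 4 * (R / (4 * T)) * Real.arsinh (2 * R / ε))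
    (hua : u₀ a = -u1) (hub : u₀ b = u1) (hlow : ∀ x ∈ Icc a b, -K ≤ u₀ x)
    (hbump : ∀ x ∈ Icc a b, |x - x₀| < r → 4 * R < u₀ x) (hx₀ : x₀ ∈ Icc a b) :
    ∀ t ∈ Icc 0 T, 0 < u x₀ t := by
  set L := Real.arsinh (2 * R / ε) with hL
  set c := L + 1 with hcdef
  set V := R / (4 * T) with hV
  have hVpos : 0 < V := by positivity
  have hVT : V * T = R / 4 := by rw [hV]; field_simp
  have hLnn : 0 ≤ L := Real.arsinh_nonneg_iff.2 (by positivity)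
  set g : ℝ → ℝ := fun y => r ^ 2 / (r ^ 2 + y ^ 2) with hg
  set g₁ : ℝ → ℝ := fun z => -(2 * r ^ 2 * z) / (r ^ 2 + z ^ 2) ^ 2
  set g₂ : ℝ → ℝ := fun y => r ^ 2 * (6 * y ^ 2 - 2 * r ^ 2) / (r ^ 2 + y ^ 2) ^ 3
  set ξ : ℝ → ℝ → ℝ := fun x t => R * (4 * g (x - x₀) - 5 / 2) - V * t with hξ
  have hg1 : ∀ y, g y ≤ 1 := fun y => by
    simp only [hg]
    rw [div_le_one (by positivity)]
    linarith [sq_nonneg y]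
  have hξ2 : ∀ x t, 0 ≤ t → ξ x t ≤ 2 * R := fun x t ht => by
    have h1 := mul_le_mul_of_nonneg_left (hg1 (x - x₀)) hR.le
    have h2 := mul_nonneg hVpos.le ht
    simp only [hξ]
    linarith
  have hS : ∀ z, z ≤ 2 * R → 1 ≤ c - Real.arsinh (z / ε) := fun z hz => by
    have : Real.arsinh (z / ε) ≤ L :=
      Real.arsinh_le_arsinh.2 (div_le_div_of_nonneg_right hz hε.le)
    linarith
  have hmono : ∀ y z, y ≤ z → z ≤ 2 * R → logProfile ε c y ≤ logProfile ε c z := by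
    intro y z hyz hz
    have := mul_sub_le_logProfile_sub hε c hyz
    nlinarith [hS z hz]
  have htop : logProfile ε c (2 * R) ≤ 4 * R := by
    have : √(ε ^ 2 + (2 * R) ^ 2) ≤ ε + 2 * R := by
      rw [Real.sqrt_le_left (by positivity)]
      nlinarith [mul_pos hε hR]
    unfold logProfile
    rw [← hL, hcdef]
    linarith
  have hP := hasDerivAt_logProfile hε c
  have hP' : ∀ z, HasDerivAt (fun z => c - Real.arsinh (z / ε)) (-(1 / √(ε ^ 2 + z ^ 2))) z :=
    fun z => (hasDerivAt_arsinh_div hε z).const_sub c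
  have hξx : ∀ x t, HasDerivAt (fun y => ξ y t) (4 * R * g₁ (x - x₀)) x := fun x t => by
    have h1 : HasDerivAt (fun y => g (y - x₀)) (g₁ (x - x₀)) x :=
      (hasDerivAt_rationalBump hr (x - x₀)).comp_sub_const x x₀
    exact ((((h1.const_mul 4).sub_const (5 / 2)).const_mul R).sub_const (V * t)).congr_deriv
      (by ring)
  have hξt : ∀ x t, HasDerivAt (fun s => ξ x s) (-V) t := fun x t =>
    (((hasDerivAt_id t).const_mul V).const_sub _).congr_deriv (by ring)
  have hg₁x : ∀ x, HasDerivAt (fun y => 4 * R * g₁ (y - x₀)) (4 * R * g₂ (x - x₀)) x := fun x =>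
    ((hasDerivAt_deriv_rationalBump hr (x - x₀)).comp_sub_const x x₀).const_mul (4 * R)
  have hwx : ∀ x t, HasDerivAt (fun y => logProfile ε c (ξ y t))
      ((c - Real.arsinh (ξ x t / ε)) * (4 * R * g₁ (x - x₀))) x := fun x t =>
    HasDerivAt.comp x (h₂ := logProfile ε c) (h := fun y => ξ y t) (hP _) (hξx x t)
  have hwt : ∀ x t, HasDerivAt (fun s => logProfile ε c (ξ x s))
      ((c - Real.arsinh (ξ x t / ε)) * -V) t := fun x t =>
    HasDerivAt.comp t (h₂ := logProfile ε c) (h := fun s => ξ x s) (hP _) (hξt x t)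
  have hwxx : ∀ x t, HasDerivAt
      (fun y => (c - Real.arsinh (ξ y t / ε)) * (4 * R * g₁ (y - x₀)))
      (-(1 / √(ε ^ 2 + ξ x t ^ 2)) * (4 * R * g₁ (x - x₀)) ^ 2
        + (c - Real.arsinh (ξ x t / ε)) * (4 * R * g₂ (x - x₀))) x := fun x t => by
    have h1 : HasDerivAt (fun y => c - Real.arsinh (ξ y t / ε))
        (-(1 / √(ε ^ 2 + ξ x t ^ 2)) * (4 * R * g₁ (x - x₀))) x :=
      HasDerivAt.comp x (h₂ := fun z => c - Real.arsinh (z / ε)) (h := fun y => ξ y t)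
        (hP' _) (hξx x t)
    exact (h1.mul (hg₁x x)).congr_deriv (by ring)
  have hcont : Continuous fun p : ℝ × ℝ => logProfile ε c (ξ p.1 p.2) := by
    refine (differentiable_logProfile hε c).continuous.comp ?_
    have : Continuous g := continuous_iff_continuousAt.2 fun y =>
      (hasDerivAt_rationalBump hr y).continuousAt
    fun_prop
  have hbdry : ∀ x ∈ Icc a b, ∀ t, 0 ≤ t → logProfile ε c (ξ x t) < u₀ x := by
    intro x hx t ht
    rcases lt_or_ge |x - x₀| r with h | h
    · have h1 := hmono _ _ (hξ2 x t ht) le_rfl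
      linarith [hbump x hx h]
    · have hgx : g (x - x₀) ≤ 1 / 2 := by
        have : r ^ 2 ≤ (x - x₀) ^ 2 := by
          rw [← sq_abs (x - x₀)]
          gcongr
        simp only [hg]
        rw [div_le_div_iff₀ (by positivity) (by positivity)]
        linarith
      have h1 : ξ x t ≤ -(R / 2) := by
        have h1 := mul_le_mul_of_nonneg_left hgx hR.le
        have h2 := mul_nonneg hVpos.le ht
        simp only [hξ]
        linarith
      have h2 := hmono _ _ h1 (by linarith)
      have h3 := mul_sub_le_logProfile_sub hε c (x := -(R / 2)) (y := 0) (by linarith)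
      rw [logProfile_zero hε] at h3
      simp only [zero_div, Real.arsinh_zero, sub_zero, zero_sub, neg_neg] at h3
      have h4 : L * (R / 2) ≤ c * (R / 2) := by gcongr; linarith
      linarith [hlow x hx]
  have key : ∀ x ∈ Icc a b, ∀ t ∈ Icc 0 T, logProfile ε c (ξ x t) < u x t := by
    refine lt_of_no_first_touch (w := fun x t => logProfile ε c (ξ x t))
      (wx := fun x t => (c - Real.arsinh (ξ x t / ε)) * (4 * R * g₁ (x - x₀)))
      (wxx := fun x t => -(1 / √(ε ^ 2 + ξ x t ^ 2)) * (4 * R * g₁ (x - x₀)) ^ 2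
        + (c - Real.arsinh (ξ x t / ε)) * (4 * R * g₂ (x - x₀)))
      (wt := fun x t => (c - Real.arsinh (ξ x t / ε)) * -V)
      hsol.cont hcont hsol.diff_x hsol.diff_xx hsol.diff_t
      hwx hwxx hwt ?_ ?_ ?_ ?_
    · intro t ht
      have haI : a ∈ Icc a b := left_mem_Icc.2 hab.le
      have : u a t = u₀ a := by
        rcases ht.1.eq_or_lt with h | h
        · rw [← h, hsol.init a haI]
        · rw [hsol.bdry_a t ⟨h, ht.2⟩, hua]
      rw [this]
      exact hbdry a haI t ht.1
    · intro t ht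
      have hbI : b ∈ Icc a b := right_mem_Icc.2 hab.le
      have : u b t = u₀ b := by
        rcases ht.1.eq_or_lt with h | h
        · rw [← h, hsol.init b hbI]
        · rw [hsol.bdry_b t ⟨h, ht.2⟩, hub]
      rw [this]
      exact hbdry b hbI t ht.1
    · intro x hx
      rw [hsol.init x hx]
      exact hbdry x hx 0 le_rfl
    · intro x t hQ heq hxx htt
      have ht : 0 < t ∧ t ≤ T := hQ.2
      have hpde := hsol.pde (x, t) hQ
      simp only at hpde heq hxx htt
      have hξle := hξ2 x t ht.1.le
      have hsub := barrier_subsolution (c := c) (ξ := ξ x t) (R := R) (r := r) (T := T)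
        (g₁ := g₁ (x - x₀)) (g₂ := g₂ (x - x₀)) (φ := Φ (u x t)) hε hR hr hT hεR hR1 hRr
        (hS _ hξle) (sq_deriv_rationalBump_le hr _) (neg_le_deriv_deriv_rationalBump hr _)
        (fun hneg => deriv_deriv_rationalBump_nonneg hr ?_) ?_
        ((hmono _ _ hξle le_rfl).trans htop)
        (heq ▸ sq_le_abs_of_rightInverse_Ureg hε.le h₂ (u x t))
        (fun h => nonneg_of_rightInverse_Ureg hε.le h₂ (heq ▸ h))
        (fun h => nonpos_of_rightInverse_Ureg hε.le h₂ (heq ▸ h))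
      · have hE : 0 ≤ ε + Φ (u x t) ^ 2 := by positivity
        have := mul_le_mul_of_nonneg_left hxx hE
        rw [← hV] at hsub
        linarith
      · have h1 : V * t ≤ R / 4 := hVT ▸ mul_le_mul_of_nonneg_left ht.2 hVpos.le
        have h2 : R * (4 * g (x - x₀) - 3) < 0 := by
          simp only [hξ] at hneg
          linarith
        have h3 : 4 * g (x - x₀) - 3 < 0 := by
          by_contra! h
          exact absurd (mul_nonneg hR.le h) (not_le.2 h2)
        change g (x - x₀) ≤ 3 / 4
        linarith
      · have : 3 / 4 * V * L ≤ 3 / 4 * V * c := by gcongr; linarith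
        linarith
  intro t ht
  have hξ0 : 0 ≤ ξ x₀ t := by
    have h1 : V * t ≤ R / 4 := hVT ▸ mul_le_mul_of_nonneg_left ht.2 hVpos.le
    have h2 : g 0 = 1 := by simp [hg, hr.ne']
    simp only [hξ, sub_self, h2]
    linarith
  have h0 := hmono _ _ hξ0 (hξ2 x₀ t ht.1)
  rw [logProfile_zero hε] at h0
  exact h0.trans_lt (key x₀ hx₀ t ht)

/-- The regularised problem is invariant under the reflection `u ↦ -u`. -/
lemma IsRegSol.neg {a b T ε u1 : ℝ} {Φ u₀ : ℝ → ℝ} {u : ℝ → ℝ → ℝ}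
    (h : IsRegSol a b T ε Φ u1 u₀ u) (hΦ : ∀ v, Φ (-v) = -Φ v) :
    IsRegSol a b T ε Φ (-u1) (fun x => -u₀ x) (fun x t => -u x t) := by
  have hx : pdx (fun x t => -u x t) = fun x t => -pdx u x t := by
    ext x t
    simp [pdx, deriv.fun_neg]
  have hxx : pdxx (fun x t => -u x t) = fun x t => -pdxx u x t := by
    ext x t
    simp [pdxx, hx, deriv.fun_neg]
  have ht : pdtW T (fun x t => -u x t) = fun x t => -pdtW T u x t := by
    ext x t
    simp [pdtW, derivWithin.fun_neg]
  constructor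
  · exact h.cont.neg
  · exact fun p hp => (h.diff_x p hp).neg
  · rw [hx]
    exact fun p hp => (h.diff_xx p hp).neg
  · exact fun p hp => (h.diff_t p hp).neg
  · rw [hx]
    exact h.cont_x.neg
  · rw [hxx]
    exact h.cont_xx.neg
  · rw [ht]
    exact h.cont_t.neg
  · intro t ht'
    rw [h.bdry_a t ht']
  · intro t ht'
    rw [h.bdry_b t ht']
  · intro x hx'
    rw [h.init x hx']
  · intro p hp
    simp only [ht, hxx, hΦ, h.pde p hp, neg_sq]
    ring

/-- Theorem 3.1 (second part), (3.14): the zero set of `u_ε` concentrates on `N`: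
`sup { dist((x,t), N) : (x,t) ∈ Q, u_ε(x,t) = 0 } → 0` as `ε → 0`. -/
theorem stmt3 (a b T : ℝ) (hab : a < b) (hT : 0 < T)
    (N₀ : Set ℝ) (u₀ : ℝ → ℝ) (h₀ : InitData a b N₀ u₀)
    (Φ : ℝ → ℝ → ℝ)
    (hΦ : ∀ ε > (0:ℝ), Function.LeftInverse (Φ ε) (Ureg ε) ∧
      Function.RightInverse (Φ ε) (Ureg ε))
    (u1 : ℝ → ℝ) (hu1 : ∀ ε > (0:ℝ), 0 < u1 ε ∧ Φ ε (u1 ε) = 1)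
    (u0e : ℝ → ℝ → ℝ)
    (h0e : ∀ ε > (0:ℝ), ContDiffOn ℝ (⊤ : ℕ∞) (u0e ε) (Set.Icc a b) ∧
      u0e ε a = -u1 ε ∧ u0e ε b = u1 ε ∧
      ∀ x ∈ Set.Icc a b, (u0e ε x = 0 ↔ x ∈ N₀))
    (h0conv : TendstoUniformlyOn (fun ε => u0e ε) u₀ (𝓝[>] (0:ℝ)) (Set.Icc a b))
    (ue : ℝ → ℝ → ℝ → ℝ)
    (hue : ∀ ε > (0:ℝ), IsRegSol a b T ε (Φ ε) (u1 ε) (u0e ε) (ue ε)) :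
    ∀ η > (0:ℝ), ∃ ε₀ > (0:ℝ), ∀ ε : ℝ, 0 < ε → ε < ε₀ →
      ∀ p ∈ QT a b T, ue ε p.1 p.2 = 0 → Metric.infDist p (NSet N₀ T) < η := by
  intro η hη
  set r := η / 2 with hr
  have hrpos : 0 < r := by positivity
  set S : Set ℝ := Icc a b ∩ ⋂ z ∈ N₀, {x | r ≤ |x - z|}
  have hSc : IsCompact S := by
    refine isCompact_Icc.inter_right (isClosed_biInter fun z _ => ?_)
    exact isClosed_le continuous_const (by fun_prop)
  have hSpos : ∀ x ∈ S, 0 < |u₀ x| := by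
    intro x hx
    rw [abs_pos]
    intro h
    have hxN := (h₀.zeros x hx.1).1 h
    have : r ≤ |x - x| := mem_iInter₂.1 hx.2 x hxN
    rw [sub_self, abs_zero] at this
    linarith
  obtain ⟨δ, hδ, hδS⟩ := hSc.exists_forall_le' (h₀.cont.abs.mono inter_subset_left) hSpos
  obtain ⟨M, hM⟩ := isCompact_Icc.exists_bound_of_continuousOn h₀.cont
  simp only [Real.norm_eq_abs] at hM
  have hM0 : 0 ≤ M := (abs_nonneg _).trans (hM a (left_mem_Icc.2 hab.le))
  set R := min (δ / 16) (min (1 / 4) (r ^ 2 / (768 * T)))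
  have hRpos : 0 < R := by positivity
  have hRδ : R ≤ δ / 16 := min_le_left _ _
  have hR1 : 4 * R ≤ 1 := by
    have : R ≤ 1 / 4 := (min_le_right _ _).trans (min_le_left _ _)
    linarith
  have hRr : 768 * T * R ≤ r ^ 2 := by
    have : R ≤ r ^ 2 / (768 * T) := (min_le_right _ _).trans (min_le_right _ _)
    rw [le_div_iff₀ (by positivity)] at this
    linarith
  have hlarge : ∀ᶠ ε in 𝓝[>] (0 : ℝ), M + 1 < R / 2 * Real.arsinh (2 * R / ε) ∧
      2 < 3 / 4 * (R / (4 * T)) * Real.arsinh (2 * R / ε) := by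
    have hlim : Tendsto (fun ε => Real.arsinh (2 * R / ε)) (𝓝[>] (0 : ℝ)) atTop := by
      have harsinh : Tendsto Real.arsinh atTop atTop :=
        Real.arsinh_strictMono.monotone.tendsto_atTop_atTop fun y =>
          ⟨Real.sinh y, (Real.arsinh_sinh y).ge⟩
      have hdiv : Tendsto (fun ε => 2 * R * ε⁻¹) (𝓝[>] (0 : ℝ)) atTop :=
        tendsto_inv_nhdsGT_zero.const_mul_atTop (by positivity)
      exact harsinh.comp hdiv
    exact ((hlim.const_mul_atTop (by positivity)).eventually_gt_atTop _).and
      ((hlim.const_mul_atTop (by positivity)).eventually_gt_atTop _)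
  have hclose := Metric.tendstoUniformlyOn_iff.1 h0conv (min (δ / 2) 1) (by positivity)
  have hsmall : ∀ᶠ ε in 𝓝[>] (0 : ℝ), ε < R := by
    filter_upwards [Ioo_mem_nhdsGT hRpos] with ε h using h.2
  obtain ⟨ε₀, hε₀, hev⟩ := mem_nhdsGT_iff_exists_Ioo_subset.1 (hlarge.and (hclose.and hsmall))
  refine ⟨ε₀, hε₀, fun ε hε hεlt p hp hzero => ?_⟩
  obtain ⟨⟨hK, hc⟩, hcl, hεR⟩ := hev ⟨hε, hεlt⟩
  by_contra! hfar
  have hxI : p.1 ∈ Icc a b := Ioo_subset_Icc_self hp.1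
  have htI : p.2 ∈ Icc 0 T := Ioc_subset_Icc_self hp.2
  have hball : ∀ x ∈ Icc a b, |x - p.1| < r → x ∈ S := by
    refine fun x hx hxr => ⟨hx, mem_iInter₂.2 fun z hz => ?_⟩
    have h1 : η ≤ |p.1 - z| := by
      have h1 := hfar.trans (Metric.infDist_le_dist_of_mem (x := p) (y := (z, p.2)) ⟨hz, htI⟩)
      simpa [Prod.dist_eq, Real.dist_eq] using h1
    have h2 := abs_sub_le p.1 x z
    rw [abs_sub_comm p.1 x] at h2
    change r ≤ |x - z|
    linarith
  obtain ⟨hsmooth, hea, heb, hez⟩ := h0e ε hε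
  have hdist : ∀ x ∈ Icc a b, |u₀ x - u0e ε x| < δ / 2 ∧ |u₀ x - u0e ε x| < 1 := fun x hx => by
    have := hcl x hx
    rw [Real.dist_eq] at this
    exact lt_min_iff.1 this
  have hbound : ∀ x ∈ Icc a b, |u0e ε x| ≤ M + 1 := fun x hx => by
    have h1 := abs_sub_abs_le_abs_sub (u0e ε x) (u₀ x)
    rw [abs_sub_comm] at h1
    linarith [hM x hx, (hdist x hx).2]
  have hbig : ∀ x ∈ Icc a b, |x - p.1| < r → 4 * R < |u0e ε x| := fun x hx hxr => by
    have h1 := abs_sub_abs_le_abs_sub (u₀ x) (u0e ε x)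
    linarith [hδS x (hball x hx hxr), (hdist x hx).1]
  have hconn : IsPreconnected (Icc a b ∩ Metric.ball p.1 r) := by
    rw [Real.ball_eq_Ioo]
    exact (ordConnected_Icc.inter ordConnected_Ioo).isPreconnected
  have hcontI : ContinuousOn (u0e ε) (Icc a b ∩ Metric.ball p.1 r) :=
    hsmooth.continuousOn.mono inter_subset_left
  have hmemI : ∀ x ∈ Icc a b, |x - p.1| < r → x ∈ Icc a b ∩ Metric.ball p.1 r :=
    fun x hx hxr => ⟨hx, by rwa [Metric.mem_ball, Real.dist_eq]⟩
  have hcenter : |p.1 - p.1| < r := by simpa using hrpos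
  have hnz : ∀ x ∈ Icc a b ∩ Metric.ball p.1 r, u0e ε x ≠ 0 := fun x hx h => by
    have := hbig x hx.1 (by simpa [Real.dist_eq] using hx.2)
    rw [h, abs_zero] at this
    linarith
  obtain ⟨hleft, hright⟩ := hΦ ε hε
  rcases lt_or_gt_of_ne (hnz _ (hmemI _ hxI hcenter)) with hsign | hsign
  · have hneg : ∀ x ∈ Icc a b, |x - p.1| < r → u0e ε x < 0 := fun x hx hxr => by
      by_contra! h
      obtain ⟨y, hy, hy0⟩ := hconn.intermediate_value (hmemI _ hxI hcenter) (hmemI x hx hxr)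
        hcontI ⟨hsign.le, h⟩
      exact hnz y hy hy0
    have := ((hue ε hε).neg (neg_of_leftInverse_rightInverse_Ureg hleft hright)).pos_of_initial_bump
      hright hab hT hε hRpos hrpos hεR.le hR1 hRr hK hc (by rw [hea]) (by rw [heb])
      (fun x hx => by linarith [(abs_le.1 (hbound x hx)).2])
      (fun x hx hxr => abs_of_neg (hneg x hx hxr) ▸ hbig x hx hxr) hxI p.2 htI
    linarith
  · have hpos : ∀ x ∈ Icc a b, |x - p.1| < r → 0 < u0e ε x := fun x hx hxr => by
      by_contra! h
      obtain ⟨y, hy, hy0⟩ := hconn.intermediate_value (hmemI x hx hxr) (hmemI _ hxI hcenter)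
        hcontI ⟨h, hsign.le⟩
      exact hnz y hy hy0
    have := (hue ε hε).pos_of_initial_bump
      hright hab hT hε hRpos hrpos hεR.le hR1 hRr hK hc hea heb
      (fun x hx => (abs_le.1 (hbound x hx)).1)
      (fun x hx hxr => abs_of_pos (hpos x hx hxr) ▸ hbig x hx hxr) hxI p.2 htI
    linarith
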